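/- For n ≥ 2, 0 < s < 1, x ∈ ℝ^n and y > 0, the fractional Laplacian applied in the x-variable to the function x ↦ (|x|² + y²)^{−(n−2s)/2} equals (Γ(n/2+s)/Γ(n/2−s)) · (2y)^{2s} · (|x|²+y²)^{−(n+2s)/2}. -/

import Mathlib

open Real MeasureTheory Set

/-- The Euclidean heat semigroup `P_t u (x)`. -/
noncomputable def heatSemigroup (n : ℕ) (t : ℝ) (u : EuclideanSpace ℝ (Fin n) → ℝ)
    (x : EuclideanSpace ℝ (Fin n)) : ℝ :=
  ∫ x' : EuclideanSpace ℝ (Fin n),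
    (4 * π * t) ^ (-(n:ℝ)/2) * Real.exp (-‖x - x'‖^2 / (4*t)) * u x'

/-- The fractional Laplacian `(-Δ)^s` defined via Balakrishnan's formula. -/
noncomputable def fracLap (n : ℕ) (s : ℝ) (u : EuclideanSpace ℝ (Fin n) → ℝ)
    (x : EuclideanSpace ℝ (Fin n)) : ℝ :=
  -(s / Real.Gamma (1 - s)) *
    ∫ t in Ioi (0:ℝ), t ^ (-1 - s) * (heatSemigroup n t u x - u x)

/-- Fubini's theorem on a product of two sets, for an integrand dominated by a product. -/
lemma setIntegral_setIntegral_swap_of_bound {α β : Type*} [MeasurableSpace α] [MeasurableSpace β]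
    {μ : Measure α} {ν : Measure β} [SFinite μ] [SFinite ν] {S : Set α} {T : Set β}
    (hS : MeasurableSet S) (hT : MeasurableSet T) {f : α → β → ℝ} {g : α → ℝ} {h : β → ℝ}
    (hf : Measurable (Function.uncurry f)) (hg : IntegrableOn g S μ) (hh : IntegrableOn h T ν)
    (hb : ∀ a ∈ S, ∀ b ∈ T, |f a b| ≤ g a * h b) :
    ∫ a in S, ∫ b in T, f a b ∂ν ∂μ = ∫ b in T, ∫ a in S, f a b ∂μ ∂ν := by
  apply integral_integral_swap
  refine (hg.mul_prod hh).mono' hf.aestronglyMeasurable ?_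
  rw [Measure.prod_restrict]
  filter_upwards [ae_restrict_mem (hS.prod hT)] with p hp
  exact hb _ hp.1 _ hp.2

lemma integrableOn_rpow_mul_exp_neg {p c : ℝ} (hp : 0 < p) (hc : 0 < c) :
    IntegrableOn (fun τ : ℝ => τ ^ (p - 1) * exp (-(c * τ))) (Ioi 0) := by
  simpa using integrableOn_rpow_mul_exp_neg_mul_rpow (p := 1) (s := p - 1) (b := c)
    (by linarith) one_pos hc

lemma Gamma_mul_rpow_neg {p r : ℝ} (hp : 0 < p) (hr : 0 < r) :
    Real.Gamma p * r ^ (-p) = ∫ τ in Ioi (0 : ℝ), τ ^ (p - 1) * exp (-(r * τ)) := by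
  rw [Real.integral_rpow_mul_exp_neg_mul_Ioi hp hr, one_div, inv_rpow hr.le, rpow_neg hr.le]
  ring

lemma integrableOn_rpow_mul_min_one {s : ℝ} (hs0 : 0 < s) (hs1 : s < 1) :
    IntegrableOn (fun t : ℝ => t ^ (-1 - s) * min 1 t) (Ioi 0) := by
  rw [← Ioc_union_Ioi_eq_Ioi (zero_le_one' ℝ), integrableOn_union]
  constructor
  · have h := (intervalIntegral.intervalIntegrable_rpow' (a := 0) (b := 1)
      (show (-1 : ℝ) < -s by linarith))
    rw [intervalIntegrable_iff_integrableOn_Ioc_of_le zero_le_one] at h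
    refine h.congr_fun (fun t ht => ?_) measurableSet_Ioc
    simp only [min_eq_right ht.2]
    rw [← rpow_add_one ht.1.ne']
    ring_nf
  · refine (integrableOn_Ioi_rpow_of_lt (show -1 - s < -1 by linarith) one_pos).congr_fun
      (fun t ht => ?_) measurableSet_Ioi
    simp [min_eq_left (le_of_lt (mem_Ioi.1 ht))]

lemma min_one_mul_le {c t : ℝ} (hc : 0 ≤ c) (ht : 0 ≤ t) :
    min 1 (c * t) ≤ (1 + c) * min 1 t := by
  rcases le_total 1 t with h | h
  · rw [min_eq_left h]
    exact (min_le_left _ _).trans (by linarith)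
  · rw [min_eq_right h]
    exact (min_le_right _ _).trans (by nlinarith)

lemma integral_rpow_mul_comp_mul {s c : ℝ} (hc : 0 < c) (g : ℝ → ℝ) :
    ∫ t in Ioi (0 : ℝ), t ^ (-1 - s) * g (c * t)
      = c ^ s * ∫ t in Ioi (0 : ℝ), t ^ (-1 - s) * g t := by
  have h := integral_comp_mul_left_Ioi (fun t => t ^ (-1 - s) * g t) 0 hc
  rw [mul_zero, smul_eq_mul] at h
  have h2 : ∫ t in Ioi (0 : ℝ), (c * t) ^ (-1 - s) * g (c * t)
      = c ^ (-1 - s) * ∫ t in Ioi (0 : ℝ), t ^ (-1 - s) * g (c * t) := by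
    rw [← integral_const_mul]
    refine setIntegral_congr_fun measurableSet_Ioi fun t ht => ?_
    simp only [mul_rpow hc.le (le_of_lt (mem_Ioi.1 ht)), mul_assoc]
  rw [h2] at h
  have h3 : c ^ s * c ^ (-1 - s) = c⁻¹ := by
    rw [← rpow_add hc, ← rpow_neg_one]
    ring_nf
  have h4 : c ^ (-1 - s) ≠ 0 := (rpow_pos_of_pos hc _).ne'
  apply mul_left_cancel₀ h4
  rw [h, ← h3]
  ring

lemma abs_exp_neg_sub_one_le {v : ℝ} (hv : 0 ≤ v) : |exp (-v) - 1| ≤ min 1 v := by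
  have h1 : exp (-v) ≤ 1 := exp_le_one_iff.2 (by linarith)
  have h2 := add_one_le_exp (-v)
  have h3 := exp_pos (-v)
  rw [abs_of_nonpos (by linarith)]
  exact le_min (by linarith) (by linarith)

/-- The Marchaud-type representation of the Gamma function at a negative argument. -/
lemma integral_rpow_mul_exp_neg_sub_one {s : ℝ} (hs0 : 0 < s) (hs1 : s < 1) :
    ∫ t in Ioi (0 : ℝ), t ^ (-1 - s) * (exp (-t) - 1) = -(Real.Gamma (1 - s) / s) := by
  have hi1 : IntegrableOn (fun t : ℝ => t ^ (-1 - s) * (exp (-t) - 1)) (Ioi 0) := by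
    refine (integrableOn_rpow_mul_min_one hs0 hs1).mono' (by fun_prop) ?_
    filter_upwards [ae_restrict_mem measurableSet_Ioi] with t ht
    have ht' : (0 : ℝ) < t := ht
    rw [norm_mul, norm_of_nonneg (rpow_nonneg ht'.le _)]
    exact mul_le_mul_of_nonneg_left (abs_exp_neg_sub_one_le ht'.le) (rpow_nonneg ht'.le _)
  have hi2 : IntegrableOn (fun t : ℝ => exp (-t) * t ^ (1 - s - 1)) (Ioi 0) :=
    Real.GammaIntegral_convergent (by linarith)
  have hder : ∀ t ∈ Ioi (0 : ℝ), HasDerivAt (fun t : ℝ => t ^ (-s) * (exp (-t) - 1))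
      (-s * (t ^ (-1 - s) * (exp (-t) - 1)) - exp (-t) * t ^ (1 - s - 1)) t := by
    intro t ht
    have ht' : (0 : ℝ) < t := ht
    have h1 := Real.hasDerivAt_rpow_const (p := -s) (Or.inl ht'.ne')
    have h2 := ((hasDerivAt_neg t).exp).sub_const 1
    convert! h1.mul h2 using 1
    rw [show -s - 1 = -1 - s by ring, show 1 - s - 1 = -s by ring]
    ring
  have h0 : Filter.Tendsto (fun t : ℝ => t ^ (-s) * (exp (-t) - 1))
      (nhdsWithin 0 (Ioi 0)) (nhds 0) := by
    have hlim : Filter.Tendsto (fun t : ℝ => t ^ (1 - s)) (nhdsWithin 0 (Ioi 0)) (nhds 0) := by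
      have := (Real.continuousAt_rpow_const 0 (1 - s) (Or.inr (by linarith))).tendsto
      rw [zero_rpow (by linarith)] at this
      exact this.mono_left nhdsWithin_le_nhds
    refine squeeze_zero_norm' ?_ hlim
    filter_upwards [self_mem_nhdsWithin] with t ht
    have ht' : (0 : ℝ) < t := ht
    rw [norm_mul, norm_of_nonneg (rpow_nonneg ht'.le _), show 1 - s = -s + 1 by ring,
      rpow_add_one ht'.ne']
    exact mul_le_mul_of_nonneg_left ((abs_exp_neg_sub_one_le ht'.le).trans (min_le_right _ _))
      (rpow_nonneg ht'.le _)
  have hinf : Filter.Tendsto (fun t : ℝ => t ^ (-s) * (exp (-t) - 1))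
      Filter.atTop (nhds 0) := by
    refine squeeze_zero_norm' ?_ (tendsto_rpow_neg_atTop hs0)
    filter_upwards [Filter.eventually_gt_atTop 0] with t ht
    rw [norm_mul, norm_of_nonneg (rpow_nonneg ht.le _)]
    exact mul_le_of_le_one_right (rpow_nonneg ht.le _)
      ((abs_exp_neg_sub_one_le ht.le).trans (min_le_left _ _))
  have hcont : ContinuousWithinAt (fun t : ℝ => t ^ (-s) * (exp (-t) - 1)) (Ici 0) 0 := by
    rw [← continuousWithinAt_Ioi_iff_Ici]
    simpa [ContinuousWithinAt] using h0
  have key := integral_Ioi_of_hasDerivAt_of_tendsto hcont hder ((hi1.const_mul (-s)).sub hi2) hinf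
  simp only [neg_zero, exp_zero, sub_self, mul_zero] at key
  rw [integral_sub (hi1.const_mul (-s)) hi2, integral_const_mul,
    ← Real.Gamma_eq_integral (by linarith)] at key
  field_simp
  linarith

lemma integral_rpow_mul_add_mul_rpow_sub {s m ρ c : ℝ} (hs0 : 0 < s) (hs1 : s < 1) (hm : 0 < m)
    (hρ : 0 < ρ) (hc : 0 < c) :
    ∫ v in Ioi (0 : ℝ), v ^ (-1 - s) * ((ρ + c * v) ^ (-m) - ρ ^ (-m))
      = -(Real.Gamma (1 - s) / s) * (Real.Gamma (m + s) / Real.Gamma m)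
          * c ^ s * ρ ^ (-(m + s)) := by
  have hΓ := (Real.Gamma_pos_of_pos hm).ne'
  have h1 : Real.Gamma m * ∫ v in Ioi (0 : ℝ), v ^ (-1 - s) * ((ρ + c * v) ^ (-m) - ρ ^ (-m))
      = ∫ v in Ioi (0 : ℝ), ∫ τ in Ioi (0 : ℝ),
          v ^ (-1 - s) * (τ ^ (m - 1) * exp (-(ρ * τ)) * (exp (-(c * τ * v)) - 1)) := by
    rw [← integral_const_mul]
    refine setIntegral_congr_fun measurableSet_Ioi fun v hv => ?_
    have hv' : (0 : ℝ) < v := hv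
    have hr : 0 < ρ + c * v := by positivity
    rw [integral_const_mul, mul_left_comm, mul_sub, Gamma_mul_rpow_neg hm hr, Gamma_mul_rpow_neg hm hρ,
      ← integral_sub (integrableOn_rpow_mul_exp_neg hm hr) (integrableOn_rpow_mul_exp_neg hm hρ)]
    congr 2 with τ
    rw [show -((ρ + c * v) * τ) = -(ρ * τ) + -(c * τ * v) by ring, exp_add]
    ring
  have h2 : ∫ v in Ioi (0 : ℝ), ∫ τ in Ioi (0 : ℝ),
          v ^ (-1 - s) * (τ ^ (m - 1) * exp (-(ρ * τ)) * (exp (-(c * τ * v)) - 1))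
      = ∫ τ in Ioi (0 : ℝ), ∫ v in Ioi (0 : ℝ),
          v ^ (-1 - s) * (τ ^ (m - 1) * exp (-(ρ * τ)) * (exp (-(c * τ * v)) - 1)) := by
    refine setIntegral_setIntegral_swap_of_bound measurableSet_Ioi measurableSet_Ioi
      (g := fun v => v ^ (-1 - s) * min 1 v)
      (h := fun τ => τ ^ (m - 1) * exp (-(ρ * τ)) + c * (τ ^ (m + 1 - 1) * exp (-(ρ * τ))))
      ?_ (integrableOn_rpow_mul_min_one hs0 hs1)
      ((integrableOn_rpow_mul_exp_neg hm hρ).add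
        ((integrableOn_rpow_mul_exp_neg (by linarith) hρ).const_mul c)) ?_
    · unfold Function.uncurry
      fun_prop
    · intro v hv τ hτ
      have hv' : (0 : ℝ) < v := hv
      have hτ' : (0 : ℝ) < τ := hτ
      have hb := (abs_exp_neg_sub_one_le (show 0 ≤ c * τ * v by positivity)).trans
        (min_one_mul_le (show 0 ≤ c * τ by positivity) hv'.le)
      rw [abs_mul, abs_mul, abs_of_nonneg (rpow_nonneg hv'.le _),
        abs_of_nonneg (show 0 ≤ τ ^ (m - 1) * exp (-(ρ * τ)) by positivity),
        show m + 1 - 1 = m - 1 + 1 by ring, rpow_add_one hτ'.ne']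
      calc _ ≤ v ^ (-1 - s) * (τ ^ (m - 1) * exp (-(ρ * τ)) * ((1 + c * τ) * min 1 v)) := by
            gcongr
        _ = _ := by ring
  have h3 : ∫ τ in Ioi (0 : ℝ), ∫ v in Ioi (0 : ℝ),
          v ^ (-1 - s) * (τ ^ (m - 1) * exp (-(ρ * τ)) * (exp (-(c * τ * v)) - 1))
      = ∫ τ in Ioi (0 : ℝ), -(Real.Gamma (1 - s) / s) * c ^ s *
          (τ ^ (m + s - 1) * exp (-(ρ * τ))) := by
    refine setIntegral_congr_fun measurableSet_Ioi fun τ hτ => ?_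
    have hτ' : (0 : ℝ) < τ := hτ
    simp only [mul_left_comm _ (τ ^ (m - 1) * exp (-(ρ * τ))) _]
    rw [integral_const_mul,
      integral_rpow_mul_comp_mul (show 0 < c * τ by positivity) (fun t => exp (-t) - 1),
      integral_rpow_mul_exp_neg_sub_one hs0 hs1, mul_rpow hc.le hτ'.le,
      show m + s - 1 = (m - 1) + s by ring, rpow_add hτ']
    ring
  rw [h2, h3, integral_const_mul, Real.integral_rpow_mul_exp_neg_mul_Ioi (by linarith) hρ,
    one_div, inv_rpow hρ.le, ← rpow_neg hρ.le] at h1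
  apply mul_left_cancel₀ hΓ
  rw [h1]
  field_simp

lemma integral_gaussian_mul_gaussian {n : ℕ} {t τ : ℝ} (ht : 0 < t) (hτ : 0 < τ)
    (x : EuclideanSpace ℝ (Fin n)) :
    ∫ z : EuclideanSpace ℝ (Fin n),
        (4 * π * t) ^ (-(n : ℝ) / 2) * exp (-‖x - z‖ ^ 2 / (4 * t)) * exp (-(‖z‖ ^ 2 * τ))
      = (1 + 4 * τ * t) ^ (-((n : ℝ) / 2)) * exp (-(‖x‖ ^ 2 * τ / (1 + 4 * τ * t))) := by
  set b : ℝ := (1 + 4 * τ * t) / (4 * t) with hb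
  have hbpos : 0 < b := by positivity
  have hC := GaussianFourier.integral_cexp_neg_mul_sq_norm_add (V := EuclideanSpace ℝ (Fin n))
    (b := (b : ℂ)) (by simpa using hbpos) ((1 / (2 * t) : ℝ) : ℂ) x
  have hR : ∫ z : EuclideanSpace ℝ (Fin n), exp (-b * ‖z‖ ^ 2 + 1 / (2 * t) * inner ℝ x z)
      = (π / b) ^ ((n : ℝ) / 2) * exp ((1 / (2 * t)) ^ 2 * ‖x‖ ^ 2 / (4 * b)) := by
    rw [finrank_euclideanSpace_fin] at hC
    rw [← Complex.ofReal_inj, ← integral_complex_ofReal]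
    push_cast [Complex.ofReal_cpow (show 0 ≤ π / b by positivity)]
    push_cast at hC
    exact hC
  have hpt : ∀ z : EuclideanSpace ℝ (Fin n),
      (4 * π * t) ^ (-(n : ℝ) / 2) * exp (-‖x - z‖ ^ 2 / (4 * t)) * exp (-(‖z‖ ^ 2 * τ))
      = (4 * π * t) ^ (-(n : ℝ) / 2) * exp (-(‖x‖ ^ 2 / (4 * t)))
        * exp (-b * ‖z‖ ^ 2 + 1 / (2 * t) * inner ℝ x z) := by
    intro z
    rw [mul_assoc ((4 * π * t) ^ (-(n : ℝ) / 2)), mul_assoc ((4 * π * t) ^ (-(n : ℝ) / 2)),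
      ← exp_add, ← exp_add, norm_sub_sq_real, hb]
    congr 2
    field_simp
    ring
  simp_rw [hpt]
  rw [integral_const_mul, hR, mul_mul_mul_comm, ← exp_add]
  congr 1
  · rw [show π / b = (4 * π * t) / (1 + 4 * τ * t) by rw [hb]; field_simp,
      div_rpow (by positivity) (by positivity), neg_div, rpow_neg (by positivity),
      rpow_neg (by positivity)]
    have : (4 * π * t) ^ ((n : ℝ) / 2) ≠ 0 := by positivity
    field_simp
  · congr 1
    rw [hb]
    field_simp
    ring

lemma integrable_exp_neg_norm_sub_sq {n : ℕ} {t : ℝ} (ht : 0 < t)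
    (x : EuclideanSpace ℝ (Fin n)) :
    Integrable fun z : EuclideanSpace ℝ (Fin n) => exp (-‖x - z‖ ^ 2 / (4 * t)) := by
  have h := GaussianFourier.integrable_cexp_neg_mul_sq_norm_add
    (V := EuclideanSpace ℝ (Fin n)) (b := ((1 / (4 * t) : ℝ) : ℂ))
    (by rw [Complex.ofReal_re]; positivity) 0 0
  have h' := (h.norm).comp_sub_left x
  refine h'.congr (Filter.Eventually.of_forall fun z => ?_)
  simp only [zero_mul, add_zero, Complex.norm_exp]
  norm_cast
  congr 1
  ring

/-- The subordination formula for the heat flow of a power of `‖z‖ ^ 2 + y ^ 2`. -/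
lemma heatSemigroup_rpow {n : ℕ} {a t y : ℝ} (ha : 0 < a) (ht : 0 < t) (hy : 0 < y)
    (x : EuclideanSpace ℝ (Fin n)) :
    Real.Gamma a * heatSemigroup n t (fun z => (‖z‖ ^ 2 + y ^ 2) ^ (-a)) x
      = ∫ τ in Ioi (0 : ℝ), τ ^ (a - 1) * exp (-(y ^ 2 * τ)) *
          ((1 + 4 * τ * t) ^ (-((n : ℝ) / 2)) * exp (-(‖x‖ ^ 2 * τ / (1 + 4 * τ * t)))) := by
  set C := (4 * π * t) ^ (-(n : ℝ) / 2) with hC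
  have hCpos : 0 < C := by positivity
  have h1 : Real.Gamma a * heatSemigroup n t (fun z => (‖z‖ ^ 2 + y ^ 2) ^ (-a)) x
      = ∫ z : EuclideanSpace ℝ (Fin n) in univ, ∫ τ in Ioi (0 : ℝ),
        τ ^ (a - 1) * exp (-(y ^ 2 * τ)) *
          (C * exp (-‖x - z‖ ^ 2 / (4 * t)) * exp (-(‖z‖ ^ 2 * τ))) := by
    rw [heatSemigroup, ← integral_const_mul, setIntegral_univ]
    congr 1 with z
    have hr : 0 < ‖z‖ ^ 2 + y ^ 2 := by positivity
    rw [mul_left_comm, Gamma_mul_rpow_neg ha hr, ← integral_const_mul]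
    congr 1 with τ
    rw [show -((‖z‖ ^ 2 + y ^ 2) * τ) = -(‖z‖ ^ 2 * τ) + -(y ^ 2 * τ) by ring, exp_add]
    ring
  rw [h1, setIntegral_setIntegral_swap_of_bound MeasurableSet.univ measurableSet_Ioi
    (g := fun z => C * exp (-‖x - z‖ ^ 2 / (4 * t)))
    (h := fun τ => τ ^ (a - 1) * exp (-(y ^ 2 * τ)))]
  · refine setIntegral_congr_fun measurableSet_Ioi fun τ hτ => ?_
    rw [setIntegral_univ, integral_const_mul, integral_gaussian_mul_gaussian ht hτ x]
  · unfold Function.uncurry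
    fun_prop
  · exact ((integrable_exp_neg_norm_sub_sq ht x).const_mul C).integrableOn
  · exact integrableOn_rpow_mul_exp_neg ha (by positivity)
  · intro z _ τ hτ
    have hτ' : (0 : ℝ) < τ := hτ
    have : exp (-(‖z‖ ^ 2 * τ)) ≤ 1 := exp_le_one_iff.2 (by simp; positivity)
    rw [abs_of_nonneg (by positivity), mul_comm]
    exact mul_le_mul_of_nonneg_right (mul_le_of_le_one_right (by positivity) this)
      (by positivity)

lemma abs_rpow_mul_exp_sub_exp_le {m B v : ℝ} (hm : 0 ≤ m) (hB : 0 ≤ B) (hv : 0 ≤ v) :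
    |(1 + v) ^ (-m) * exp (-(B / (1 + v))) - exp (-B)| ≤ (1 + m + B) * min 1 v := by
  have hp0 : 0 < (1 + v) ^ (-m) := by positivity
  have hp1 : (1 + v) ^ (-m) ≤ 1 := rpow_le_one_of_one_le_of_nonpos (by linarith) (by linarith)
  have hp2 : 1 - m * v ≤ (1 + v) ^ (-m) := by
    rw [rpow_def_of_pos (by positivity)]
    have h1 := log_le_sub_one_of_pos (show 0 < 1 + v by positivity)
    have h2 := add_one_le_exp (log (1 + v) * -m)
    nlinarith
  have hBle : B / (1 + v) ≤ B := div_le_self hB (by linarith)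
  have hBge : B - B * v ≤ B / (1 + v) := by
    rw [le_div_iff₀ (by positivity)]
    nlinarith [mul_nonneg hB (sq_nonneg v)]
  have hBpos : 0 ≤ B / (1 + v) := by positivity
  set E := exp (-(B / (1 + v)))
  have hE1 : E ≤ 1 := exp_le_one_iff.2 (by linarith)
  have hE0 : exp (-B) ≤ E := exp_le_exp.2 (by linarith)
  have hF0 := exp_pos (-B)
  have hEF : E - exp (-B) ≤ B * v := by
    have h1 : exp (-B) = E * exp (-(B - B / (1 + v))) := by
      rw [← exp_add]; congr 1; ring
    have h2 := add_one_le_exp (-(B - B / (1 + v)))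
    nlinarith [mul_le_mul_of_nonneg_left h2 (hF0.le.trans hE0)]
  have hup : (1 + v) ^ (-m) * E ≤ E := mul_le_of_le_one_left (hF0.le.trans hE0) hp1
  have hlow : exp (-B) - m * v ≤ (1 + v) ^ (-m) * E := by
    have h1 : (1 + v) ^ (-m) * exp (-B) ≤ (1 + v) ^ (-m) * E := by gcongr
    have h2 : (1 - m * v) * exp (-B) ≤ (1 + v) ^ (-m) * exp (-B) := by gcongr
    have h3 : m * v * exp (-B) ≤ m * v :=
      mul_le_of_le_one_right (by positivity) (hE0.trans hE1)
    nlinarith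
  have hpE : 0 < (1 + v) ^ (-m) * E := mul_pos hp0 (hF0.trans_le hE0)
  have hmv : 0 ≤ m * v := by positivity
  have hBv : 0 ≤ B * v := by positivity
  rcases le_total 1 v with h | h
  · rw [min_eq_left h, abs_le]
    constructor <;> nlinarith
  · rw [min_eq_right h, abs_le]
    constructor <;> nlinarith

theorem stmt_11 (n : ℕ) (hn : 2 ≤ n) (s : ℝ) (hs0 : 0 < s) (hs1 : s < 1)
    (x : EuclideanSpace ℝ (Fin n)) (y : ℝ) (hy : 0 < y) :
    fracLap n s (fun x' => (‖x'‖^2 + y^2) ^ (-(((n:ℝ) - 2*s)/2))) x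
      = Real.Gamma ((n:ℝ)/2 + s) / Real.Gamma ((n:ℝ)/2 - s)
          * (2*y) ^ (2*s) * (‖x‖^2 + y^2) ^ (-(((n:ℝ) + 2*s)/2)) := by
  have hn' : (2 : ℝ) ≤ n := by exact_mod_cast hn
  set m : ℝ := (n : ℝ) / 2 with hm
  set a : ℝ := m - s with ha
  set A : ℝ := ‖x‖ ^ 2 with hA
  have hA0 : 0 ≤ A := by positivity
  have hmpos : 0 < m := by linarith
  have hapos : 0 < a := by linarith
  have hρ : 0 < A + y ^ 2 := by positivity
  have hy2 : 0 < y ^ 2 := by positivity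
  rw [show ((n : ℝ) - 2 * s) / 2 = a by rw [ha, hm]; ring,
    show ((n : ℝ) + 2 * s) / 2 = m + s by rw [hm]; ring]
  set D : ℝ → ℝ → ℝ := fun τ v =>
    (1 + v) ^ (-m) * exp (-(A * τ / (1 + v))) - exp (-(A * τ)) with hD
  have hDb : ∀ τ v : ℝ, 0 < τ → 0 < v → |D τ v| ≤ (1 + m + A * τ) * min 1 v :=
    fun τ v hτ hv => abs_rpow_mul_exp_sub_exp_le hmpos.le (by positivity) hv.le
  have hw := fun p (hp : 0 < p) => integrableOn_rpow_mul_exp_neg hp hy2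
  have hexp : ∀ B : ℝ, 0 ≤ B → ‖exp (-B)‖ ≤ 1 := fun B hB => by
    rw [norm_of_nonneg (exp_pos _).le]; exact exp_le_one_iff.2 (by linarith)
  have hpow : ∀ v : ℝ, 0 ≤ v → ‖(1 + v) ^ (-m)‖ ≤ 1 := fun v hv => by
    rw [norm_of_nonneg (by positivity)]
    exact rpow_le_one_of_one_le_of_nonpos (by linarith) (by linarith)
  have hint1 : ∀ (p : ℝ) (v : ℝ → ℝ), 0 < p → Measurable v → (∀ τ, 0 < τ → 0 ≤ v τ) →
      IntegrableOn (fun τ : ℝ => τ ^ (p - 1) * exp (-(y ^ 2 * τ)) *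
        ((1 + v τ) ^ (-m) * exp (-(A * τ / (1 + v τ))))) (Ioi 0) := by
    intro p v hp hv hv0
    refine Integrable.mono (hw p hp) (by fun_prop) ?_
    filter_upwards [ae_restrict_mem measurableSet_Ioi] with τ hτ
    have hτ' : (0 : ℝ) < τ := hτ
    have hvτ := hv0 τ hτ'
    rw [norm_mul]
    refine mul_le_of_le_one_right (norm_nonneg _) ?_
    rw [norm_mul]
    exact mul_le_one₀ (hpow _ hvτ) (norm_nonneg _) (hexp _ (by positivity))
  have h1 : Real.Gamma a * ∫ t in Ioi (0 : ℝ), t ^ (-1 - s) *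
        (heatSemigroup n t (fun x' => (‖x'‖ ^ 2 + y ^ 2) ^ (-a)) x - (A + y ^ 2) ^ (-a))
      = ∫ t in Ioi (0 : ℝ), ∫ τ in Ioi (0 : ℝ),
        t ^ (-1 - s) * (τ ^ (a - 1) * exp (-(y ^ 2 * τ)) * D τ (4 * τ * t)) := by
    rw [← integral_const_mul]
    refine setIntegral_congr_fun measurableSet_Ioi fun t ht => ?_
    have ht' : (0 : ℝ) < t := ht
    rw [integral_const_mul, mul_left_comm, mul_sub, heatSemigroup_rpow hapos ht' hy,
      Gamma_mul_rpow_neg hapos hρ, ← integral_sub]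
    · congr 2 with τ
      rw [hD, show -((A + y ^ 2) * τ) = -(y ^ 2 * τ) + -(A * τ) by ring, exp_add]
      ring
    · exact hint1 a (fun τ => 4 * τ * t) hapos (by fun_prop) (fun τ hτ => by positivity)
    · exact integrableOn_rpow_mul_exp_neg hapos hρ
  have h2 : ∫ t in Ioi (0 : ℝ), ∫ τ in Ioi (0 : ℝ),
        t ^ (-1 - s) * (τ ^ (a - 1) * exp (-(y ^ 2 * τ)) * D τ (4 * τ * t))
      = ∫ τ in Ioi (0 : ℝ), ∫ t in Ioi (0 : ℝ),
        t ^ (-1 - s) * (τ ^ (a - 1) * exp (-(y ^ 2 * τ)) * D τ (4 * τ * t)) := by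
    refine setIntegral_setIntegral_swap_of_bound measurableSet_Ioi measurableSet_Ioi
      (g := fun t => t ^ (-1 - s) * min 1 t)
      (h := fun τ => (1 + m) * (τ ^ (a - 1) * exp (-(y ^ 2 * τ)))
        + (A + 4 * (1 + m)) * (τ ^ (a + 1 - 1) * exp (-(y ^ 2 * τ)))
        + 4 * A * (τ ^ (a + 1 + 1 - 1) * exp (-(y ^ 2 * τ))))
      ?_ (integrableOn_rpow_mul_min_one hs0 hs1)
      ((((hw a hapos).const_mul _).add ((hw (a + 1) (by linarith)).const_mul _)).add
        ((hw (a + 1 + 1) (by linarith)).const_mul _)) ?_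
    · unfold Function.uncurry
      fun_prop
    · intro t ht τ hτ
      have ht' : (0 : ℝ) < t := ht
      have hτ' : (0 : ℝ) < τ := hτ
      have hb := (hDb τ (4 * τ * t) hτ' (by positivity)).trans
        (mul_le_mul_of_nonneg_left (min_one_mul_le (show 0 ≤ 4 * τ by positivity) ht'.le)
          (by positivity))
      rw [abs_mul, abs_mul, abs_of_nonneg (rpow_nonneg ht'.le _),
        abs_of_nonneg (show 0 ≤ τ ^ (a - 1) * exp (-(y ^ 2 * τ)) by positivity),
        show a + 1 + 1 - 1 = a - 1 + 1 + 1 by ring, show a + 1 - 1 = a - 1 + 1 by ring,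
        rpow_add_one hτ'.ne' (a - 1 + 1),
        rpow_add_one hτ'.ne' (a - 1)]
      calc _ ≤ t ^ (-1 - s) * (τ ^ (a - 1) * exp (-(y ^ 2 * τ)) *
              ((1 + m + A * τ) * ((1 + 4 * τ) * min 1 t))) := by gcongr
        _ = _ := by ring
  have h3 : ∫ τ in Ioi (0 : ℝ), ∫ t in Ioi (0 : ℝ),
        t ^ (-1 - s) * (τ ^ (a - 1) * exp (-(y ^ 2 * τ)) * D τ (4 * τ * t))
      = ∫ τ in Ioi (0 : ℝ), ∫ v in Ioi (0 : ℝ),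
        4 ^ s * (v ^ (-1 - s) * (τ ^ (m - 1) * exp (-(y ^ 2 * τ)) * D τ v)) := by
    refine setIntegral_congr_fun measurableSet_Ioi fun τ hτ => ?_
    have hτ' : (0 : ℝ) < τ := hτ
    simp only [mul_left_comm _ (τ ^ (a - 1) * exp (-(y ^ 2 * τ))) _,
      mul_left_comm _ (τ ^ (m - 1) * exp (-(y ^ 2 * τ))) _]
    rw [integral_const_mul, integral_const_mul, integral_const_mul,
      integral_rpow_mul_comp_mul (show 0 < 4 * τ by positivity) (D τ),
      mul_rpow (by norm_num) hτ'.le, show m - 1 = a - 1 + s by rw [ha]; ring, rpow_add hτ']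
    ring
  have h4 : ∫ τ in Ioi (0 : ℝ), ∫ v in Ioi (0 : ℝ),
        4 ^ s * (v ^ (-1 - s) * (τ ^ (m - 1) * exp (-(y ^ 2 * τ)) * D τ v))
      = ∫ v in Ioi (0 : ℝ), ∫ τ in Ioi (0 : ℝ),
        4 ^ s * (v ^ (-1 - s) * (τ ^ (m - 1) * exp (-(y ^ 2 * τ)) * D τ v)) := by
    refine setIntegral_setIntegral_swap_of_bound measurableSet_Ioi measurableSet_Ioi
      (g := fun τ => 4 ^ s * ((1 + m) * (τ ^ (m - 1) * exp (-(y ^ 2 * τ)))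
        + A * (τ ^ (m + 1 - 1) * exp (-(y ^ 2 * τ)))))
      (h := fun v => v ^ (-1 - s) * min 1 v) ?_
      ((((hw m hmpos).const_mul _).add ((hw (m + 1) (by linarith)).const_mul _)).const_mul _)
      (integrableOn_rpow_mul_min_one hs0 hs1) ?_
    · unfold Function.uncurry
      fun_prop
    · intro τ hτ v hv
      have hv' : (0 : ℝ) < v := hv
      have hτ' : (0 : ℝ) < τ := hτ
      have hb := hDb τ v hτ' hv'
      rw [abs_mul, abs_mul, abs_mul, abs_of_nonneg (rpow_nonneg hv'.le _),
        abs_of_nonneg (show 0 ≤ τ ^ (m - 1) * exp (-(y ^ 2 * τ)) by positivity),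
        abs_of_nonneg (show (0 : ℝ) ≤ 4 ^ s by positivity),
        show m + 1 - 1 = m - 1 + 1 by ring, rpow_add_one hτ'.ne']
      calc _ ≤ 4 ^ s * (v ^ (-1 - s) * (τ ^ (m - 1) * exp (-(y ^ 2 * τ)) *
              ((1 + m + A * τ) * min 1 v))) := by gcongr
        _ = _ := by ring
  have h5 : ∫ v in Ioi (0 : ℝ), ∫ τ in Ioi (0 : ℝ),
        4 ^ s * (v ^ (-1 - s) * (τ ^ (m - 1) * exp (-(y ^ 2 * τ)) * D τ v))
      = 4 ^ s * Real.Gamma m * ∫ v in Ioi (0 : ℝ),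
        v ^ (-1 - s) * ((A + y ^ 2 + y ^ 2 * v) ^ (-m) - (A + y ^ 2) ^ (-m)) := by
    rw [← integral_const_mul]
    refine setIntegral_congr_fun measurableSet_Ioi fun v hv => ?_
    have hv' : (0 : ℝ) < v := hv
    have hr : 0 < A / (1 + v) + y ^ 2 := by positivity
    have hmul : (1 + v) ^ (-m) * (A / (1 + v) + y ^ 2) ^ (-m)
        = (A + y ^ 2 + y ^ 2 * v) ^ (-m) := by
      rw [← mul_rpow (by positivity) hr.le]
      congr 1
      field_simp
      ring
    have hin : ∫ τ in Ioi (0 : ℝ), τ ^ (m - 1) * exp (-(y ^ 2 * τ)) * D τ v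
        = Real.Gamma m * ((A + y ^ 2 + y ^ 2 * v) ^ (-m) - (A + y ^ 2) ^ (-m)) := by
      rw [← hmul, mul_sub, mul_left_comm, Gamma_mul_rpow_neg hmpos hr, Gamma_mul_rpow_neg hmpos hρ,
        ← integral_const_mul, ← integral_sub]
      · congr 1 with τ
        rw [hD, show -((A + y ^ 2) * τ) = -(y ^ 2 * τ) + -(A * τ) by ring, exp_add,
          show -((A / (1 + v) + y ^ 2) * τ) = -(y ^ 2 * τ) + -(A * τ / (1 + v)) by ring, exp_add]
        ring
      · exact (integrableOn_rpow_mul_exp_neg hmpos hr).const_mul _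
      · exact integrableOn_rpow_mul_exp_neg hmpos hρ
    rw [integral_const_mul, integral_const_mul, hin]
    ring
  rw [h2, h3, h4, h5, integral_rpow_mul_add_mul_rpow_sub hs0 hs1 hmpos hρ hy2] at h1
  have hΓa := (Real.Gamma_pos_of_pos hapos).ne'
  have hΓm := (Real.Gamma_pos_of_pos hmpos).ne'
  have hΓs := (Real.Gamma_pos_of_pos (show 0 < 1 - s by linarith)).ne'
  have hyy : (2 * y) ^ (2 * s) = 4 ^ s * (y ^ 2) ^ s := by
    rw [rpow_mul (by positivity), ← mul_rpow (by norm_num) hy2.le]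
    norm_num [mul_pow]
  rw [fracLap, hyy]
  apply mul_left_cancel₀ hΓa
  rw [mul_left_comm, h1]
  field_simp
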